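/- arXiv:0910.3890 — 3 statements merged into one kernel-verified Lean document; each statement's English description precedes it below -/
import Mathlib

section
/- Let F : ℝ^n → ℝ^n be a smooth vector field and f, g : ℝ^n → ℝ smooth functions such that f^(1)_y(F(y)) = g(y) for all y ∈ ℝ^n. Then L_F f^(1) = g^(1), and for every integer k ≥ 2 and every x ∈ ℝ^n, (L_F f^(k))_x = g^(k)_x − Σ_{l=2}^{k} binom(k,l)·(f^(k+1−l)_x ⊙ F^(l)_x), as an equality of k-multilinear maps (ℝ^n)^k → ℝ. -/
open scoped BigOperators

/-- The symmetric composition `Q ⊙ H` of a symmetric `(s+1)`-multilinear scalar-valued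
map `Q` and a `k`-multilinear vector-valued map `H`, as a `(k+s)`-multilinear map. -/
noncomputable def symComp {E : Type*} {s k : ℕ}
    (Q : (Fin (s + 1) → E) → ℝ) (H : (Fin k → E) → E) :
    (Fin (k + s) → E) → ℝ := fun v =>
  ((k + s).factorial : ℝ)⁻¹ *
    ∑ σ : Equiv.Perm (Fin (k + s)),
      Q (Fin.cons (H fun i => v (σ (Fin.castAdd s i))) fun j => v (σ (Fin.natAdd k j)))

section SymmetricIteratedDerivative

variable {E G : Type*} [NormedAddCommGroup E] [NormedSpace ℝ E]
  [NormedAddCommGroup G] [NormedSpace ℝ G]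

lemma ContDiff.differentiable_iteratedFDeriv_of_smooth {f : E → G}
    (hf : ContDiff ℝ (⊤ : ℕ∞) f) (n : ℕ) : Differentiable ℝ (iteratedFDeriv ℝ n f) :=
  hf.differentiable_iteratedFDeriv (by exact_mod_cast ENat.natCast_lt_top n)

lemma ContDiff.smooth_iteratedFDeriv {f : E → G}
    (hf : ContDiff ℝ (⊤ : ℕ∞) f) (n : ℕ) : ContDiff ℝ (⊤ : ℕ∞) (iteratedFDeriv ℝ n f) :=
  hf.iteratedFDeriv_right (by exact_mod_cast le_top)

lemma ContDiff.smooth_fderiv {f : E → G}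
    (hf : ContDiff ℝ (⊤ : ℕ∞) f) : ContDiff ℝ (⊤ : ℕ∞) (fderiv ℝ f) :=
  hf.fderiv_right (by exact_mod_cast le_top)

lemma ContDiff.isSymmSndFDerivAt_of_smooth {f : E → G}
    (hf : ContDiff ℝ (⊤ : ℕ∞) f) (x : E) : IsSymmSndFDerivAt ℝ f x :=
  hf.contDiffAt.isSymmSndFDerivAt (by
    rw [minSmoothness_of_isRCLikeNormedField]
    exact WithTop.coe_le_coe.mpr (le_top : (2 : ℕ∞) ≤ ⊤))

lemma iteratedFDeriv_succ_apply_fderiv {f : E → G} (hf : ContDiff ℝ (⊤ : ℕ∞) f) {n : ℕ}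
    (x : E) (v : Fin (n + 1) → E) :
    iteratedFDeriv ℝ (n + 1) f x v
      = fderiv ℝ (fun y => iteratedFDeriv ℝ n f y (Fin.tail v)) x (v 0) := by
  rw [iteratedFDeriv_succ_apply_left, fderiv_continuousMultilinear_apply_const
    (hf.differentiable_iteratedFDeriv_of_smooth n x)]
  rfl

lemma iteratedFDeriv_comp_swap {f : E → G} (hf : ContDiff ℝ (⊤ : ℕ∞) f) :
    ∀ {n : ℕ} (i : Fin n) (x : E) (v : Fin (n + 1) → E),
      iteratedFDeriv ℝ (n + 1) f x (v ∘ Equiv.swap i.castSucc i.succ)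
        = iteratedFDeriv ℝ (n + 1) f x v
  | 0, i, _, _ => i.elim0
  | n + 1, i, x, v => by
    have hd := hf.smooth_iteratedFDeriv n
    have hd2 : ∀ w : Fin (n + 2) → E, iteratedFDeriv ℝ (n + 2) f x w
        = fderiv ℝ (fderiv ℝ (iteratedFDeriv ℝ n f)) x (w 0) (w 1) (Fin.tail (Fin.tail w)) := by
      intro w
      have hd' : DifferentiableAt ℝ (fderiv ℝ (iteratedFDeriv ℝ n f)) x :=
        hd.smooth_fderiv.differentiable (by simp) x
      rw [iteratedFDeriv_succ_apply_fderiv hf]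
      simp only [iteratedFDeriv_succ_apply_left]
      rw [fderiv_continuousMultilinear_apply_const (by fun_prop)]
      rw [fderiv_clm_apply (by fun_prop) (by fun_prop)]
      simp [Fin.tail]
    refine Fin.cases ?_ (fun j => ?_) i
    · rw [hd2, hd2]
      have h : ∀ w : Fin (n + 2) → E, w ∘ Equiv.swap (Fin.castSucc 0) (Fin.succ 0)
          = Fin.cons (w 1) (Fin.cons (w 0) (Fin.tail (Fin.tail w))) := by
        intro w
        funext k
        refine Fin.cases (by simp) (fun k => Fin.cases (by simp) (fun k => ?_) k) k
        have h2 : k.succ.succ ≠ (1 : Fin (n + 2)) := by simp [Fin.ext_iff]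
        simp [Equiv.swap_apply_of_ne_of_ne, h2, Fin.tail]
      rw [h, Fin.cons_one, (hd.isSymmSndFDerivAt_of_smooth x).eq]
      simp only [Fin.cons_zero, Fin.tail_cons]
    · rw [iteratedFDeriv_succ_apply_fderiv hf, iteratedFDeriv_succ_apply_fderiv hf x v]
      have h0 : (v ∘ Equiv.swap j.succ.castSucc j.succ.succ) 0 = v 0 := by
        rw [Function.comp_apply, Equiv.swap_apply_of_ne_of_ne] <;> simp [Fin.ext_iff]
      have ht : Fin.tail (v ∘ Equiv.swap j.succ.castSucc j.succ.succ)
          = Fin.tail v ∘ Equiv.swap j.castSucc j.succ := by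
        funext k
        simp only [Fin.tail, Function.comp_apply]
        congr 1
        rw [← Fin.succ_castSucc]
        exact (Fin.succ_injective _).swap_apply j.castSucc j.succ k
      rw [h0, ht]
      congr 2
      funext y
      exact iteratedFDeriv_comp_swap hf j y _

theorem ContDiff.iteratedFDeriv_comp_perm_of_smooth {f : E → G} (hf : ContDiff ℝ (⊤ : ℕ∞) f)
    {n : ℕ} (σ : Equiv.Perm (Fin n)) (x : E) (v : Fin n → E) :
    iteratedFDeriv ℝ n f x (v ∘ σ) = iteratedFDeriv ℝ n f x v := by
  cases n with
  | zero => exact congrArg _ (Subsingleton.elim _ _)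
  | succ n =>
    have hσ : σ ∈ Submonoid.closure
        (Set.range fun i : Fin n => Equiv.swap i.castSucc i.succ) := by
      rw [Equiv.Perm.mclosure_swap_castSucc_succ]
      trivial
    induction hσ using Submonoid.closure_induction generalizing v with
    | mem _ h =>
      obtain ⟨i, rfl⟩ := h
      exact iteratedFDeriv_comp_swap hf i x v
    | one => rfl
    | mul a b _ _ ha hb => exact (hb (v ∘ a)).trans (ha v)

lemma iteratedFDeriv_cons_const {f : E → G} (hf : ContDiff ℝ (⊤ : ℕ∞) f) (n : ℕ) (x u w : E) :
    iteratedFDeriv ℝ (n + 1) f x (Fin.cons u fun _ => w)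
      = iteratedFDeriv ℝ n (fderiv ℝ f) x (fun _ => w) u := by
  rw [← hf.iteratedFDeriv_comp_perm_of_smooth (finRotate (n + 1)), iteratedFDeriv_succ_apply_right]
  have h : (Fin.cons u (fun _ => w) : Fin (n + 1) → E) ∘ finRotate (n + 1)
      = Fin.snoc (fun _ => w) u := by
    funext k
    refine Fin.lastCases (by simp) (fun k => ?_) k
    simp
  rw [h]
  simp

end SymmetricIteratedDerivative

section Leibniz

variable {E G H : Type*} [NormedAddCommGroup E] [NormedSpace ℝ E]
  [NormedAddCommGroup G] [NormedSpace ℝ G] [NormedAddCommGroup H] [NormedSpace ℝ H]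

/-- The Leibniz rule for iterated derivatives in a fixed direction. -/
theorem iteratedFDeriv_clm_apply_const {A : E → G →L[ℝ] H} {B : E → G}
    (hA : ContDiff ℝ (⊤ : ℕ∞) A) (hB : ContDiff ℝ (⊤ : ℕ∞) B) (w : E) (k : ℕ) (x : E) :
    iteratedFDeriv ℝ k (fun y => A y (B y)) x (fun _ => w)
      = ∑ ij ∈ Finset.HasAntidiagonal.antidiagonal k, k.choose ij.1 •
          iteratedFDeriv ℝ ij.1 A x (fun _ => w) (iteratedFDeriv ℝ ij.2 B x fun _ => w) := by
  induction k generalizing x with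
  | zero => simp
  | succ k ih =>
    have hdA (i : ℕ) : DifferentiableAt ℝ (fun y => iteratedFDeriv ℝ i A y fun _ => w) x :=
      (hA.differentiable_iteratedFDeriv_of_smooth i x).continuousMultilinear_apply_const _
    have hdB (i : ℕ) : DifferentiableAt ℝ (fun y => iteratedFDeriv ℝ i B y fun _ => w) x :=
      (hB.differentiable_iteratedFDeriv_of_smooth i x).continuousMultilinear_apply_const _
    have hsA (i : ℕ) : iteratedFDeriv ℝ (i + 1) A x (fun _ => w)
        = fderiv ℝ (fun y => iteratedFDeriv ℝ i A y fun _ => w) x w :=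
      iteratedFDeriv_succ_apply_fderiv hA x _
    have hsB (i : ℕ) : iteratedFDeriv ℝ (i + 1) B x (fun _ => w)
        = fderiv ℝ (fun y => iteratedFDeriv ℝ i B y fun _ => w) x w :=
      iteratedFDeriv_succ_apply_fderiv hB x _
    rw [iteratedFDeriv_succ_apply_fderiv (hA.clm_apply hB)]
    simp only [Fin.tail_def, ih]
    rw [fderiv_fun_sum fun ij _ => ((hdA ij.1).clm_apply (hdB ij.2)).fun_const_smul _,
      Finset.sum_antidiagonal_choose_succ_nsmul (fun i j =>
        iteratedFDeriv ℝ i A x (fun _ => w) (iteratedFDeriv ℝ j B x fun _ => w)) k,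
      ← Finset.sum_add_distrib, sum_apply]
    refine Finset.sum_congr rfl fun ij hij => ?_
    rw [← Nat.choose_symm_of_eq_add (Finset.HasAntidiagonal.mem_antidiagonal.mp hij).symm, hsA, hsB,
      fderiv_fun_const_smul ((hdA ij.1).clm_apply (hdB ij.2)), fderiv_clm_apply (hdA _) (hdB _)]
    simp

end Leibniz

section Polarization

variable {E : Type*} [NormedAddCommGroup E] [NormedSpace ℝ E]

/-- The space of symmetric continuous `k`-multilinear forms, as functions. -/
def symMultilinear (E : Type*) [NormedAddCommGroup E] [NormedSpace ℝ E] (k : ℕ) :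
    Submodule ℝ ((Fin k → E) → ℝ) where
  carrier := {φ | (∃ P : ContinuousMultilinearMap ℝ (fun _ : Fin k => E) ℝ, ⇑P = φ) ∧
    ∀ (σ : Equiv.Perm (Fin k)) (v : Fin k → E), φ (v ∘ σ) = φ v}
  add_mem' := by
    rintro _ _ ⟨⟨P, rfl⟩, hP⟩ ⟨⟨Q, rfl⟩, hQ⟩
    exact ⟨⟨P + Q, rfl⟩, fun σ v => by simp [hP, hQ]⟩
  zero_mem' := ⟨⟨0, rfl⟩, fun _ _ => rfl⟩
  smul_mem' := by
    rintro c _ ⟨⟨P, rfl⟩, hP⟩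
    exact ⟨⟨c • P, rfl⟩, fun σ v => by simp [hP]⟩

lemma symMultilinear_eq_zero_of_diagonal {k : ℕ} {φ : (Fin k → E) → ℝ}
    (hφ : φ ∈ symMultilinear E k) (h : ∀ w, φ (fun _ => w) = 0) : φ = 0 := by
  induction k with
  | zero =>
    funext v
    rw [Subsingleton.elim v fun _ => 0]
    exact h 0
  | succ k ih =>
    obtain ⟨⟨P, rfl⟩, hP⟩ := hφ
    have hcons (u w : E) : P (Fin.cons u fun _ => w) = 0 := by
      have hd := (P.hasFDerivAt fun _ => w).comp w
        (hasFDerivAt_pi.2 fun _ : Fin (k + 1) => hasFDerivAt_id (𝕜 := ℝ) w)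
      have h0 : (⇑P ∘ fun (y : E) (_ : Fin (k + 1)) => y) = fun _ => 0 := funext h
      have hu := congrArg (fun L => L u) ((h0 ▸ hd).unique (hasFDerivAt_const (0 : ℝ) w))
      have hj (j : Fin (k + 1)) :
          P (Function.update (fun _ => w) j u) = P (Fin.cons u fun _ => w) := by
        rw [← hP (Equiv.swap 0 j)]
        congr 1
        funext i
        refine Fin.cases ?_ (fun i => ?_) i
        · simp
        · rw [Function.comp_apply, Fin.cons_succ, Function.update_of_ne]
          rw [Ne, Equiv.swap_apply_eq_iff, Equiv.swap_apply_right]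
          exact Fin.succ_ne_zero i
      simpa [hj, Nat.cast_add_one_ne_zero] using hu
    funext v
    have hmem : (fun v' => P (Fin.cons (v 0) v')) ∈ symMultilinear E k := by
      refine ⟨⟨P.curryLeft (v 0), rfl⟩, fun σ v' => ?_⟩
      beta_reduce
      rw [← hP (Equiv.Perm.decomposeFin.symm (0, σ)) (Fin.cons (v 0) v')]
      congr 1
      funext i
      refine Fin.cases ?_ (fun i => ?_) i <;> simp
    rw [← Fin.cons_self_tail v]
    exact congrFun (ih hmem fun w => hcons (v 0) w) (Fin.tail v)

lemma symMultilinear_ext_diagonal {k : ℕ} {φ ψ : (Fin k → E) → ℝ}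
    (hφ : φ ∈ symMultilinear E k) (hψ : ψ ∈ symMultilinear E k)
    (h : ∀ w, φ (fun _ => w) = ψ (fun _ => w)) : φ = ψ :=
  sub_eq_zero.mp <| symMultilinear_eq_zero_of_diagonal (sub_mem hφ hψ) fun w => by simp [h]

lemma sum_update_mem_symMultilinear {k : ℕ} {φ : (Fin k → E) → ℝ}
    (hφ : φ ∈ symMultilinear E k) (A : E →L[ℝ] E) :
    (fun v => ∑ j, φ (Function.update v j (A (v j)))) ∈ symMultilinear E k := by
  obtain ⟨⟨P, rfl⟩, hP⟩ := hφ
  refine ⟨⟨∑ j, P.compContinuousLinearMap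
    (Function.update (fun _ => ContinuousLinearMap.id ℝ E) j A), ?_⟩, fun σ v => ?_⟩
  · funext v
    rw [sum_apply]
    refine Finset.sum_congr rfl fun j _ => congrArg P (funext fun i => ?_)
    rcases eq_or_ne i j with rfl | hij <;> simp [*]
  · refine Fintype.sum_equiv σ _ _ fun j => ?_
    rw [← hP σ (Function.update v (σ j) _)]
    congr 1
    exact (Function.update_comp_eq_of_injective v σ.injective j _).symm

lemma symComp_mem_symMultilinear {s k : ℕ}
    (Q : ContinuousMultilinearMap ℝ (fun _ : Fin (s + 1) => E) ℝ)
    (H : ContinuousMultilinearMap ℝ (fun _ : Fin k => E) E) :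
    symComp Q H ∈ symMultilinear E (k + s) := by
  let M (σ : Equiv.Perm (Fin (k + s))) : ContinuousMultilinearMap ℝ (fun _ : Fin (k + s) => E) ℝ :=
    { ((Q.toMultilinearMap.curryLeft.compMultilinearMap
        H.toMultilinearMap).uncurrySum).domDomCongr (finSumFinEquiv.trans σ) with
      cont := by
        change Continuous fun v : Fin (k + s) → E => Q (Fin.cons
          (H fun i => v (σ (Fin.castAdd s i))) fun j => v (σ (Fin.natAdd k j)))
        refine Q.cont.comp (continuous_pi fun i => Fin.cases ?_ (fun i => ?_) i)
        · exact H.cont.comp (by fun_prop)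
        · simp only [Fin.cons_succ]
          fun_prop }
  refine ⟨⟨((k + s).factorial : ℝ)⁻¹ • ∑ σ, M σ, ?_⟩, fun τ v => ?_⟩
  · funext v
    rw [smul_apply, sum_apply]
    rfl
  · exact congrArg (((k + s).factorial : ℝ)⁻¹ * ·) (Fintype.sum_equiv (Equiv.mulLeft τ) _ _ fun σ => rfl)

lemma symComp_cast_mem_symMultilinear {s k N N' : ℕ} (hN : s + 1 = N) (hN' : k + s = N')
    (Q : ContinuousMultilinearMap ℝ (fun _ : Fin N => E) ℝ)
    (H : ContinuousMultilinearMap ℝ (fun _ : Fin k => E) E) :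
    (fun v => symComp (s := s) (fun w => Q fun i => w (Fin.cast hN.symm i)) (fun w => H w)
      fun i => v (Fin.cast hN' i)) ∈ symMultilinear E N' := by
  subst hN hN'
  exact symComp_mem_symMultilinear Q H

lemma symComp_const {E : Type*} {s k : ℕ} (Q : (Fin (s + 1) → E) → ℝ) (H : (Fin k → E) → E)
    (w : E) :
    symComp Q H (fun _ => w) = Q (Fin.cons (H fun _ => w) fun _ => w) := by
  have h : ((k + s).factorial : ℝ) ≠ 0 := by exact_mod_cast (k + s).factorial_ne_zero
  simp [symComp, Fintype.card_perm, h]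

end Polarization

section LieDerivative

variable {E : Type*} [NormedAddCommGroup E] [NormedSpace ℝ E]

lemma iteratedFDeriv_mem_symMultilinear {f : E → ℝ} (hf : ContDiff ℝ (⊤ : ℕ∞) f) (k : ℕ) (x : E) :
    (fun v => iteratedFDeriv ℝ k f x v) ∈ symMultilinear E k :=
  ⟨⟨_, rfl⟩, fun σ v => hf.iteratedFDeriv_comp_perm_of_smooth σ x v⟩

lemma fderiv_iteratedFDeriv_mem_symMultilinear {f : E → ℝ} (hf : ContDiff ℝ (⊤ : ℕ∞) f) (k : ℕ)
    (x u : E) :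
    (fun v => fderiv ℝ (fun y => iteratedFDeriv ℝ k f y v) x u) ∈ symMultilinear E k := by
  refine ⟨⟨fderiv ℝ (iteratedFDeriv ℝ k f) x u, ?_⟩, fun σ v => ?_⟩
  · funext v
    rw [fderiv_continuousMultilinear_apply_const
      (hf.differentiable_iteratedFDeriv_of_smooth k x)]
    rfl
  · simp only [hf.iteratedFDeriv_comp_perm_of_smooth σ]

lemma iteratedFDeriv_cast_cons_const {f : E → ℝ} (hf : ContDiff ℝ (⊤ : ℕ∞) f) {s N : ℕ}
    (hN : s + 1 = N) (x u w : E) :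
    iteratedFDeriv ℝ N f x
        (fun i => (Fin.cons u fun _ => w : Fin (s + 1) → E) (Fin.cast hN.symm i))
      = iteratedFDeriv ℝ s (fderiv ℝ f) x (fun _ => w) u := by
  subst hN
  exact iteratedFDeriv_cons_const hf s x u w

lemma iteratedFDeriv_update_const {f : E → ℝ} (hf : ContDiff ℝ (⊤ : ℕ∞) f) (s : ℕ)
    (j : Fin (s + 1)) (x u w : E) :
    iteratedFDeriv ℝ (s + 1) f x (Function.update (fun _ => w) j u)
      = iteratedFDeriv ℝ s (fderiv ℝ f) x (fun _ => w) u := by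
  rw [← iteratedFDeriv_cons_const hf, ← hf.iteratedFDeriv_comp_perm_of_smooth (Equiv.swap 0 j)]
  congr 1
  funext i
  refine Fin.cases ?_ (fun i => ?_) i
  · simp
  · rw [Function.comp_apply, Fin.cons_succ, Function.update_of_ne]
    rw [Ne, Equiv.swap_apply_eq_iff, Equiv.swap_apply_right]
    exact Fin.succ_ne_zero i

end LieDerivative

/-- If `F f = g` (directional derivative of `f` along `F`), then `L_F f⁽¹⁾ = g⁽¹⁾` and,
for every `k ≥ 2` (written `K + 2`), `L_F f⁽ᵏ⁾ = g⁽ᵏ⁾ − ∑_{l=2}^{k} C(k,l) f⁽ᵏ⁺¹⁻ˡ⁾ ⊙ F⁽ˡ⁾`.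
Here `(L_F Q)_x(v₁,…,v_k) = D_{F(x)}Q (v₁,…,v_k) + ∑_j Q_x(v₁,…,F⁽¹⁾(v_j),…,v_k)`. -/
theorem stmt_2 {n : ℕ}
    (F : EuclideanSpace ℝ (Fin n) → EuclideanSpace ℝ (Fin n)) (hF : ContDiff ℝ (⊤ : ℕ∞) F)
    (f g : EuclideanSpace ℝ (Fin n) → ℝ) (hf : ContDiff ℝ (⊤ : ℕ∞) f) (hg : ContDiff ℝ (⊤ : ℕ∞) g)
    (hfg : ∀ y, fderiv ℝ f y (F y) = g y) :
    (∀ (x v : EuclideanSpace ℝ (Fin n)),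
        fderiv ℝ (fun y => fderiv ℝ f y v) x (F x) + fderiv ℝ f x (fderiv ℝ F x v)
          = fderiv ℝ g x v) ∧
      ∀ (K : ℕ) (x : EuclideanSpace ℝ (Fin n)) (v : Fin (K + 2) → EuclideanSpace ℝ (Fin n)),
        fderiv ℝ (fun y => iteratedFDeriv ℝ (K + 2) f y v) x (F x)
          + ∑ j : Fin (K + 2),
              iteratedFDeriv ℝ (K + 2) f x (Function.update v j (fderiv ℝ F x (v j)))
        = iteratedFDeriv ℝ (K + 2) g x v
          - ∑ m : Fin (K + 1), ((K + 2).choose ((m : ℕ) + 2) : ℝ) *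
              symComp (s := K - (m : ℕ))
                (fun w => iteratedFDeriv ℝ (K + 1 - (m : ℕ)) f x
                  (fun i => w (Fin.cast (by have := m.isLt; omega) i)))
                (fun w => iteratedFDeriv ℝ ((m : ℕ) + 2) F x w)
                (fun i => v (Fin.cast (by have := m.isLt; omega) i)) := by
  have hg_eq : g = fun y => fderiv ℝ f y (F y) := funext fun y => (hfg y).symm
  have hf' := hf.smooth_fderiv
  constructor
  · intro x v
    have hd : DifferentiableAt ℝ (fderiv ℝ f) x := hf'.differentiable (by simp) x
    have hdF : DifferentiableAt ℝ F x := hF.differentiable (by simp) x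
    rw [hg_eq, fderiv_clm_apply hd hdF, fderiv_clm_apply hd (by fun_prop)]
    simp [(hf.isSymmSndFDerivAt_of_smooth x).eq v (F x), add_comm]
  · intro K x v
    have key := symMultilinear_ext_diagonal
      (add_mem (fderiv_iteratedFDeriv_mem_symMultilinear hf (K + 2) x (F x))
        (sum_update_mem_symMultilinear (iteratedFDeriv_mem_symMultilinear hf (K + 2) x)
          (fderiv ℝ F x)))
      (sub_mem (iteratedFDeriv_mem_symMultilinear hg (K + 2) x)
        (sum_mem fun (m : Fin (K + 1)) (_ : m ∈ Finset.univ) =>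
          Submodule.smul_mem _ ((K + 2).choose (m + 2) : ℝ)
            (symComp_cast_mem_symMultilinear (s := K - m) (N := K + 1 - m) (N' := K + 2) (by omega) (by omega)
              (iteratedFDeriv ℝ (K + 1 - m) f x) (iteratedFDeriv ℝ (m + 2) F x))))
      fun w => ?_
    · have key' := congrFun key v
      simp only [Pi.add_apply, Pi.sub_apply, Finset.sum_apply, Pi.smul_apply, smul_eq_mul] at key'
      exact key'
    · have hcons : fderiv ℝ (fun y => iteratedFDeriv ℝ (K + 2) f y fun _ => w) x (F x)
          = iteratedFDeriv ℝ (K + 2) (fderiv ℝ f) x (fun _ => w) (F x) := by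
        rw [← iteratedFDeriv_cons_const hf, iteratedFDeriv_succ_apply_fderiv hf]
        simp
      have hterm (m : Fin (K + 1)) := iteratedFDeriv_cast_cons_const hf
        (s := K - m) (N := K + 1 - m) (by omega) x
        (iteratedFDeriv ℝ (m + 2) F x fun _ => w) w
      have hF1 : iteratedFDeriv ℝ 1 F x (fun _ => w) = fderiv ℝ F x w := by
        simp
      have hL := iteratedFDeriv_clm_apply_const hf' hF w (K + 2) x
      rw [← hg_eq, ← Finset.Nat.sum_antidiagonal_swap,
        Finset.Nat.sum_antidiagonal_eq_sum_range_succ_mk, Finset.sum_range_succ',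
        Finset.sum_range_succ', Finset.sum_range] at hL
      simp only [Pi.add_apply, Pi.sub_apply, Finset.sum_apply, Pi.smul_apply, smul_eq_mul,
        symComp_const, hterm, hcons,
        iteratedFDeriv_update_const hf]
      have hsub (m : Fin (K + 1)) :
          (K + 2).choose (K + 2 - (m + 1 + 1)) •
              iteratedFDeriv ℝ (K + 2 - (m + 1 + 1)) (fderiv ℝ f) x (fun _ => w)
                (iteratedFDeriv ℝ (m + 1 + 1) F x fun _ => w)
            = ((K + 2).choose (m + 2) : ℝ) *
              iteratedFDeriv ℝ (K - m) (fderiv ℝ f) x (fun _ => w)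
                (iteratedFDeriv ℝ (m + 2) F x fun _ => w) := by
        rw [Nat.choose_symm (by omega), show K + 2 - ((m : ℕ) + 1 + 1) = K - m by omega,
          nsmul_eq_mul]
      simp only [Prod.swap_prod_mk, hsub] at hL
      rw [hL]
      simp [hF1, Nat.choose_succ_self_right]
      ring
end

section
/- Let F, X : ℝ^n → ℝ^n be smooth vector fields and x ↦ Q_x a smooth field of k-multilinear maps (ℝ^n)^k → ℝ. Let D_X Q denote the field x ↦ (D_{X(x)} Q)_x, and let [F,X] be the Lie bracket [F,X](y) = X^(1)_y(F(y)) − F^(1)_y(X(y)). Then for all x and v_1,…,v_k: (L_F(D_X Q))_x(v_1,…,v_k) − (D_{X(x)}(L_F Q))_x(v_1,…,v_k) = (D_{[F,X](x)} Q)_x(v_1,…,v_k) − Σ_{j=1}^{k} Q_x(v_1,…,F^(2)_x(X(x), v_j),…,v_k). -/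
open scoped BigOperators

section MultilinearField

variable {ι E G H : Type*} [Fintype ι]
  [NormedAddCommGroup E] [NormedSpace ℝ E] [NormedAddCommGroup G] [NormedSpace ℝ G]
  [NormedAddCommGroup H] [NormedSpace ℝ H]

/-- Derivative of a field of multilinear maps evaluated at a tuple of which only the `j`-th entry
varies. -/
theorem HasFDerivAt.continuousMultilinearMap_apply_update [DecidableEq ι]
    {Q : E → ContinuousMultilinearMap ℝ (fun _ : ι => G) H}
    {Q' : E →L[ℝ] ContinuousMultilinearMap ℝ (fun _ : ι => G) H}
    {g : E → G} {g' : E →L[ℝ] G} {x : E}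
    (hQ : HasFDerivAt Q Q' x) (hg : HasFDerivAt g g' x) (v : ι → G) (j : ι) :
    HasFDerivAt (fun y => Q y (Function.update v j (g y)))
      (ContinuousMultilinearMap.apply ℝ (fun _ : ι => G) H (Function.update v j (g x)) ∘L Q' +
        (Q x).toContinuousLinearMap v j ∘L g') x := by
  have hupd : ∀ i, HasFDerivAt (fun y => Function.update v j (g y) i)
      ((Pi.single j g' : ι → E →L[ℝ] G) i) x := by
    intro i
    rcases eq_or_ne i j with rfl | hij
    · simpa using hg
    · simpa [hij] using hasFDerivAt_const (v i) x
  convert! hQ.continuousMultilinearMap_apply hupd using 2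
  rw [Finset.sum_eq_single j]
  · ext u
    simp
  · intro i _ hij
    simp [hij]
  · simp

/-- Derivative of `y ↦ (D_{X(y)} Q)_y(v)`. -/
theorem DifferentiableAt.hasFDerivAt_fderiv_apply_apply
    {Q : E → ContinuousMultilinearMap ℝ (fun _ : ι => G) H} {X : E → E} {x : E}
    (hQ : DifferentiableAt ℝ (fderiv ℝ Q) x) (hX : DifferentiableAt ℝ X x) (v : ι → G) :
    HasFDerivAt (fun y => fderiv ℝ Q y (X y) v)
      (ContinuousMultilinearMap.apply ℝ (fun _ : ι => G) H v ∘L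
        (fderiv ℝ Q x ∘L fderiv ℝ X x + (fderiv ℝ (fderiv ℝ Q) x).flip (X x))) x :=
  (ContinuousMultilinearMap.apply ℝ (fun _ : ι => G) H v).hasFDerivAt.comp x
    (hQ.hasFDerivAt.clm_apply hX.hasFDerivAt)

end MultilinearField

/-- Commutator identity `[L_F, D_X]Q = D_{[F,X]}Q + 𝒜_{F⁽²⁾(X,·)}Q` for a smooth field
`Q` of `k`-multilinear maps and smooth vector fields `F`, `X`, where
`(L_F Q)_x(v) = (D_{F(x)}Q)_x(v) + ∑_j Q_x(v₁,…,F⁽¹⁾(v_j),…,v_k)` and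
`[F,X](y) = X⁽¹⁾_y(F(y)) − F⁽¹⁾_y(X(y))`. -/
theorem stmt_4 {n k : ℕ}
    (F X : EuclideanSpace ℝ (Fin n) → EuclideanSpace ℝ (Fin n))
    (hF : ContDiff ℝ (⊤ : ℕ∞) F) (hX : ContDiff ℝ (⊤ : ℕ∞) X)
    (Q : EuclideanSpace ℝ (Fin n) →
      ContinuousMultilinearMap ℝ (fun _ : Fin k => EuclideanSpace ℝ (Fin n)) ℝ)
    (hQ : ContDiff ℝ (⊤ : ℕ∞) Q)
    (x : EuclideanSpace ℝ (Fin n)) (v : Fin k → EuclideanSpace ℝ (Fin n)) :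
    -- (L_F (D_X Q))_x(v), where (D_X Q)_y = (fderiv ℝ Q y) (X y) :
    (fderiv ℝ (fun y => fderiv ℝ Q y (X y) v) x (F x)
        + ∑ j : Fin k, fderiv ℝ Q x (X x) (Function.update v j (fderiv ℝ F x (v j))))
    -- − (D_{X(x)} (L_F Q))_x(v) :
      - fderiv ℝ (fun y => fderiv ℝ Q y (F y) v
          + ∑ j : Fin k, Q y (Function.update v j (fderiv ℝ F y (v j)))) x (X x)
    -- = (D_{[F,X](x)} Q)_x(v) − ∑_j Q_x(v₁,…,F⁽²⁾(X(x),v_j),…,v_k) :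
    = fderiv ℝ Q x (fderiv ℝ X x (F x) - fderiv ℝ F x (X x)) v
      - ∑ j : Fin k, Q x (Function.update v j (iteratedFDeriv ℝ 2 F x ![X x, v j])) := by
  have hQ₁ : DifferentiableAt ℝ Q x := hQ.differentiable (by simp) x
  have hQ₂ : DifferentiableAt ℝ (fderiv ℝ Q) x :=
    (hQ.fderiv_right (m := 1) (by norm_cast)).differentiable (by simp) x
  have hF₁ : DifferentiableAt ℝ F x := hF.differentiable (by simp) x
  have hF₂ : DifferentiableAt ℝ (fderiv ℝ F) x :=
    (hF.fderiv_right (m := 1) (by norm_cast)).differentiable (by simp) x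
  have hX₁ : DifferentiableAt ℝ X x := hX.differentiable (by simp) x
  have hsymm : fderiv ℝ (fderiv ℝ Q) x (F x) (X x) = fderiv ℝ (fderiv ℝ Q) x (X x) (F x) :=
    hQ.contDiffAt.isSymmSndFDerivAt (by simp; norm_cast) (F x) (X x)
  have hact : ∀ j, HasFDerivAt (fun y => Q y (Function.update v j (fderiv ℝ F y (v j)))) _ x :=
    fun j => hQ₁.hasFDerivAt.continuousMultilinearMap_apply_update
      (hF₂.hasFDerivAt.clm_apply (hasFDerivAt_const (v j) x)) v j
  rw [(hQ₂.hasFDerivAt_fderiv_apply_apply hX₁ v).fderiv,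
    ((hQ₂.hasFDerivAt_fderiv_apply_apply hF₁ v).fun_add
      (HasFDerivAt.fun_sum fun j _ => hact j)).fderiv]
  simp [iteratedFDeriv_two_apply, Finset.sum_add_distrib, hsymm]
  ring
end

section
/- Assume the hyperbolic periodic orbit setup. Let k ≥ 1 and let (B_t)_{t ∈ ℝ} be a continuous T-periodic family of k-multilinear maps (ℝ^n)^k → ℝ. Suppose A_t and A'_t are two T-periodic, differentiable-in-t families of k-multilinear maps, both solving (d/dt)A_t(v_1,…,v_k) + Σ_{j=1}^{k} A_t(v_1,…,F^(1)_{x(t)}(v_j),…,v_k) = B_t(v_1,…,v_k) for all t and all v_1,…,v_k. Then A'_t = A_t + μ·Q^(1)_t ⊗ ⋯ ⊗ Q^(1)_t for all t, where μ = T^k·[A'_0(F_0,…,F_0) − A_0(F_0,…,F_0)] with F_0 = F(x), and (Q^(1)_t ⊗ ⋯ ⊗ Q^(1)_t)(v_1,…,v_k) = Π_{j=1}^k Q^(1)_t(v_j). -/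
open scoped BigOperators

/-- The `k`-fold tensor power `q ⊗ ⋯ ⊗ q` of a linear functional, as a continuous
`k`-multilinear map: `(q ⊗ ⋯ ⊗ q)(v₁,…,v_k) = ∏ⱼ q(vⱼ)`. -/
noncomputable def tensorPow {E : Type*} [NormedAddCommGroup E] [NormedSpace ℝ E]
    (k : ℕ) (q : E →L[ℝ] ℝ) : ContinuousMultilinearMap ℝ (fun _ : Fin k => E) ℝ :=
  (ContinuousMultilinearMap.mkPiAlgebra ℝ (Fin k) ℝ).compContinuousLinearMap fun _ => q

open Filter Topology

/-- A family of continuous multilinear forms on a finite-dimensional space that is differentiable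
when evaluated at every vector is differentiable in norm. -/
theorem ContinuousMultilinearMap.exists_hasDerivAt_of_forall_apply {ι E : Type*} [Fintype ι]
    [NormedAddCommGroup E] [NormedSpace ℝ E] [FiniteDimensional ℝ E]
    {A : ℝ → ContinuousMultilinearMap ℝ (fun _ : ι => E) ℝ} {a : (ι → E) → ℝ} {t : ℝ}
    (hA : ∀ v, HasDerivAt (fun s => A s v) (a v) t) :
    ∃ A', HasDerivAt A A' t ∧ ∀ v, A' v = a v := by
  classical
  let b := Module.finBasis ℝ E
  let R : ContinuousMultilinearMap ℝ (fun _ : ι => E) ℝ →ₗ[ℝ]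
      ((ι → Fin (Module.finrank ℝ E)) → ℝ) :=
    { toFun := fun f i => f fun j => b (i j)
      map_add' := fun _ _ => rfl
      map_smul' := fun _ _ => rfl }
  have hR : LinearMap.ker R = ⊥ := by
    refine LinearMap.ker_eq_bot.2 fun f g hfg => ?_
    exact ContinuousMultilinearMap.toMultilinearMap_injective
      (Module.Basis.ext_multilinear (fun _ => b) fun i => congrFun hfg i)
  obtain ⟨L, hL⟩ := R.exists_leftInverse_of_injective hR
  have hLR : ∀ f, LinearMap.toContinuousLinearMap L (R f) = f := fun f => LinearMap.congr_fun hL f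
  have hd : HasDerivAt (fun s => R (A s)) (fun i => a fun j => b (i j)) t :=
    hasDerivAt_pi.2 fun i => hA _
  have h := (LinearMap.toContinuousLinearMap L).hasFDerivAt.comp_hasDerivAt t hd
  have h' : HasDerivAt A (LinearMap.toContinuousLinearMap L fun i => a fun j => b (i j)) t :=
    h.congr_of_eventuallyEq (Eventually.of_forall fun s => (hLR (A s)).symm)
  refine ⟨_, h', fun v => HasDerivAt.unique ?_ (hA v)⟩
  exact (ContinuousMultilinearMap.apply ℝ (fun _ : ι => E) ℝ v).hasFDerivAt.comp_hasDerivAt t h'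

/-- A solution of the homogeneous variational tensor equation is constant along solutions of the
linear variational equation. -/
theorem ContinuousMultilinearMap.apply_eq_of_hasDerivAt_variational {ι E : Type*} [Fintype ι]
    [DecidableEq ι] [NormedAddCommGroup E] [NormedSpace ℝ E] [FiniteDimensional ℝ E]
    {M : ℝ → E →L[ℝ] E} {A : ℝ → ContinuousMultilinearMap ℝ (fun _ : ι => E) ℝ}
    (hA : ∀ t v, HasDerivAt (fun s => A s v)
      (-∑ j, A t (Function.update v j (M t (v j)))) t)
    {V : ι → ℝ → E} (hV : ∀ j t, HasDerivAt (V j) (M t (V j t)) t) (s t : ℝ) :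
    A s (fun j => V j s) = A t (fun j => V j t) := by
  have key : ∀ t, HasDerivAt (fun s => A s fun j => V j s) 0 t := by
    intro t
    obtain ⟨A', hA', hA'v⟩ := exists_hasDerivAt_of_forall_apply (hA t)
    have h := (hA'.hasFDerivAt.continuousMultilinearMap_apply
      fun j => (hV j t).hasFDerivAt).hasDerivAt
    convert! h using 1
    simp [hA'v]
  exact is_const_of_deriv_eq_zero (fun t => (key t).differentiableAt) (fun t => (key t).deriv) s t

/-- A family of maps solving an autonomous `C¹` differential equation is a flow. -/
theorem apply_apply_eq_apply_add_of_hasDerivAt {E : Type*} [NormedAddCommGroup E]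
    [NormedSpace ℝ E] [CompleteSpace E] {F : E → E} (hF : ContDiff ℝ 1 F) {φ : ℝ → E → E}
    (hφ0 : ∀ y, φ 0 y = y) (hφ : ∀ t y, HasDerivAt (fun s => φ s y) (F (φ t y)) t)
    (s t : ℝ) (x : E) : φ s (φ t x) = φ (t + s) x := by
  have h1 : IsMIntegralCurve (I := modelWithCornersSelf ℝ E) (fun s => φ s (φ t x)) F :=
    fun r => (hφ r (φ t x)).hasFDerivAt.hasMFDerivAt
  have h2 : IsMIntegralCurve (I := modelWithCornersSelf ℝ E) (fun s => φ (t + s) x) F :=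
    fun r => ((hφ (t + r) x).comp_const_add t r).hasFDerivAt.hasMFDerivAt
  exact congrFun (isMIntegralCurve_Ioo_eq_of_contMDiff_boundaryless (t₀ := 0)
    (contMDiff_vectorSpace_iff_contDiff.2 hF) h1 h2 (by simp [hφ0])) s

/-- The spatial derivative of a flow solves the linear variational equation. -/
theorem hasDerivAt_fderiv_flow {E : Type*} [NormedAddCommGroup E] [NormedSpace ℝ E]
    {F : E → E} (hF : Differentiable ℝ F) {φ : ℝ → E → E}
    (hφs : ContDiff ℝ 2 fun p : ℝ × E => φ p.1 p.2)
    (hφ : ∀ t y, HasDerivAt (fun s => φ s y) (F (φ t y)) t) (y v : E) (s : ℝ) :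
    HasDerivAt (fun r => fderiv ℝ (φ r) y v) (fderiv ℝ F (φ s y) (fderiv ℝ (φ s) y v)) s := by
  set g : ℝ × E → E := fun p => φ p.1 p.2 with hg
  have hgd : ∀ p, HasFDerivAt g (fderiv ℝ g p) p :=
    fun p => (hφs.differentiable two_ne_zero p).hasFDerivAt
  have hx : ∀ r z, fderiv ℝ (φ r) z v = fderiv ℝ g (r, z) (0, v) := fun r z => by
    have := (hgd (r, z)).comp z ((hasFDerivAt_const r z).prodMk (hasFDerivAt_id z))
    have h : HasFDerivAt (φ r) _ z := this
    simp [h.fderiv]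
  have ht : ∀ p, fderiv ℝ g p (1, 0) = F (g p) := fun p => by
    have := (hgd (p.1, p.2)).comp_hasDerivAt p.1
      ((hasDerivAt_id p.1).prodMk (hasDerivAt_const p.1 p.2))
    exact HasDerivAt.unique this (hφ p.1 p.2)
  have hg2 : ∀ p, HasFDerivAt (fderiv ℝ g) (fderiv ℝ (fderiv ℝ g) p) p := fun p =>
    ((hφs.fderiv_right (m := 1) (by norm_num)).differentiable one_ne_zero p).hasFDerivAt
  have hsymm := (hφs.contDiffAt (x := (s, y))).isSymmSndFDerivAt (by simp) (1, 0) (0, v)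
  have h1 : HasDerivAt (fun r => fderiv ℝ g (r, y) (0, v))
      (fderiv ℝ (fderiv ℝ g) (s, y) (1, 0) (0, v)) s := by
    have := (hg2 (s, y)).comp_hasDerivAt s ((hasDerivAt_id s).prodMk (hasDerivAt_const s y))
    simpa using this.clm_apply (hasDerivAt_const s ((0 : ℝ), v))
  have h2 : fderiv ℝ (fderiv ℝ g) (s, y) (0, v) (1, 0)
      = fderiv ℝ F (φ s y) (fderiv ℝ (φ s) y v) := by
    have e1 : HasFDerivAt (fun p => fderiv ℝ g p (1, 0)) _ (s, y) :=
      (hg2 (s, y)).clm_apply (hasFDerivAt_const ((1 : ℝ), (0 : E)) (s, y))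
    have e2 : HasFDerivAt (fun p => F (g p)) _ (s, y) :=
      (hF (g (s, y))).hasFDerivAt.comp (s, y) (hgd (s, y))
    simp only [ht] at e1
    have := DFunLike.congr_fun (e1.unique e2) (0, v)
    simpa [hx, hg] using this
  simp only [hx] at h2 ⊢
  rw [← h2, ← hsymm]
  exact h1

/-- The tensor powers of a solution of Malkin's equation solve the homogeneous variational tensor
equation. -/
theorem hasDerivAt_tensorPow {E : Type*} [NormedAddCommGroup E] [NormedSpace ℝ E]
    {k : ℕ} {q : ℝ → E →L[ℝ] ℝ} {M : E →L[ℝ] E} {t : ℝ}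
    (hq : ∀ v, HasDerivAt (fun s => q s v) (-(q t (M v))) t) (v : Fin k → E) :
    HasDerivAt (fun s => tensorPow k (q s) v)
      (-∑ j, tensorPow k (q t) (Function.update v j (M (v j)))) t := by
  have h := HasDerivAt.fun_finsetProd (u := Finset.univ) fun j _ => hq (v j)
  simp only [tensorPow, ContinuousMultilinearMap.compContinuousLinearMap_apply,
    ContinuousMultilinearMap.mkPiAlgebra_apply]
  convert! h using 1
  rw [← Finset.sum_neg_distrib]
  refine Finset.sum_congr rfl fun j _ => ?_
  rw [← Finset.mul_prod_erase _ _ (Finset.mem_univ j), Function.update_self, smul_eq_mul, mul_comm,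
    mul_neg]
  congr 2
  refine Finset.prod_congr rfl fun i hi => ?_
  rw [Function.update_of_ne (Finset.ne_of_mem_erase hi)]

/-- A periodic solution of the homogeneous variational tensor equation along a hyperbolic periodic
orbit vanishes as soon as it vanishes on the vector field at one point of the orbit. -/
theorem eq_zero_of_periodic_of_variational {ι E : Type*} [Fintype ι] [DecidableEq ι]
    [NormedAddCommGroup E] [NormedSpace ℝ E] [FiniteDimensional ℝ E]
    {F : E → E} (hF : ContDiff ℝ 1 F) {φ : ℝ → E → E} (hφ0 : ∀ y, φ 0 y = y)
    (hφs : ContDiff ℝ 2 fun p : ℝ × E => φ p.1 p.2)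
    (hφ : ∀ t y, HasDerivAt (fun s => φ s y) (F (φ t y)) t)
    {x : E} {T : ℝ} (hT : 0 < T) (hper : φ T x = x) {W : ℝ → Submodule ℝ E}
    (hW : ∀ t, IsCompl (Submodule.span ℝ {F (φ t x)}) (W t))
    {C lam : ℝ} (hlam0 : 0 < lam) (hlam1 : lam < 1)
    (hcontr : ∀ t s : ℝ, 0 ≤ s → ∀ v ∈ W t,
      ‖fderiv ℝ (φ s) (φ t x) v‖ ≤ C * lam ^ s * ‖v‖)
    {A : ℝ → ContinuousMultilinearMap ℝ (fun _ : ι => E) ℝ} (hAper : Function.Periodic A T)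
    (hA : ∀ t v, HasDerivAt (fun s => A s v)
      (-∑ j, A t (Function.update v j (fderiv ℝ F (φ t x) (v j)))) t)
    (hA0 : A 0 (fun _ => F x) = 0) (t : ℝ) : A t = 0 := by
  have hFd : Differentiable ℝ F := hF.differentiable one_ne_zero
  have hadd := apply_apply_eq_apply_add_of_hasDerivAt hF hφ0 hφ
  have hxper : Function.Periodic (fun t => φ t x) T := fun t => by
    simp only [add_comm t T, ← hadd, hper]
  have hfield : ∀ t, HasDerivAt (fun s => F (φ s x)) (fderiv ℝ F (φ t x) (F (φ t x))) t :=
    fun t => (hFd _).hasFDerivAt.comp_hasDerivAt t (hφ t x)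
  have hAF : ∀ t, A t (fun _ => F (φ t x)) = 0 := fun t => by
    rw [ContinuousMultilinearMap.apply_eq_of_hasDerivAt_variational hA
      (V := fun _ s => F (φ s x)) (fun _ => hfield) t 0, hφ0, hA0]
  have hflowF : ∀ (m : ℕ), fderiv ℝ (φ (m * T)) (φ t x) (F (φ t x)) = F (φ t x) := fun m => by
    have h1 : HasDerivAt (fun r => φ (m * T) (φ r x)) _ t :=
      ((hφs.comp (contDiff_const.prodMk contDiff_id)).differentiable two_ne_zero
        (φ t x)).hasFDerivAt.comp_hasDerivAt t (hφ t x)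
    have h2 : (fun r => φ (m * T) (φ r x)) = fun r => φ r x := by
      ext1 r
      rw [hadd]
      exact hxper.nat_mul m r
    rw [h2] at h1
    exact h1.unique (hφ t x)
  ext v
  have hinv : ∀ m : ℕ, A t (fun j => fderiv ℝ (φ (m * T)) (φ t x) (v j)) = A t v := fun m => by
    have hB : ∀ s w, HasDerivAt (fun r => A (t + r) w)
        (-∑ j, A (t + s) (Function.update w j (fderiv ℝ F (φ (t + s) x) (w j)))) s :=
      fun s w => (hA (t + s) w).comp_const_add t s
    have h := ContinuousMultilinearMap.apply_eq_of_hasDerivAt_variational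
      (A := fun s => A (t + s)) (M := fun s => fderiv ℝ F (φ (t + s) x)) hB
      (V := fun j s => fderiv ℝ (φ s) (φ t x) (v j))
      (fun j s => by
        simpa only [hadd] using hasDerivAt_fderiv_flow hFd hφs hφ (φ t x) (v j) s) (m * T) 0
    have hid : φ 0 = id := funext hφ0
    simpa [hid, hAper.nat_mul m t] using h
  have hlim : ∀ w, ∃ c : ℝ, Tendsto (fun m : ℕ => fderiv ℝ (φ (m * T)) (φ t x) w) atTop
      (𝓝 (c • F (φ t x))) := fun w => by
    have hw : w ∈ Submodule.span ℝ {F (φ t x)} ⊔ W t := by simp [(hW t).sup_eq_top]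
    obtain ⟨u, hu, z, hz, rfl⟩ := Submodule.mem_sup.1 hw
    obtain ⟨c, rfl⟩ := Submodule.mem_span_singleton.1 hu
    refine ⟨c, ?_⟩
    have hz0 : Tendsto (fun m : ℕ => fderiv ℝ (φ (m * T)) (φ t x) z) atTop (𝓝 0) := by
      refine squeeze_zero_norm (a := fun m : ℕ => C * lam ^ (m * T) * ‖z‖)
        (fun m => hcontr t _ (by positivity) z hz) ?_
      have h1 : Tendsto (fun m : ℕ => (lam ^ T) ^ m) atTop (𝓝 0) :=
        tendsto_pow_atTop_nhds_zero_of_lt_one (by positivity)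
          (Real.rpow_lt_one hlam0.le hlam1 hT)
      have h2 : ∀ m : ℕ, lam ^ (m * T) = (lam ^ T) ^ m := fun m => by
        rw [mul_comm, Real.rpow_mul_natCast hlam0.le]
      simpa [h2] using (h1.const_mul C).mul_const ‖z‖
    simpa [hflowF] using hz0.const_add (c • F (φ t x))
  choose c hc using hlim
  have h1 := ((A t).cont.tendsto _).comp (tendsto_pi_nhds.2 fun j => hc (v j))
  have h2 : A t (fun j => c (v j) • F (φ t x)) = 0 := by
    rw [ContinuousMultilinearMap.map_smul_univ, hAF, smul_zero]
  refine tendsto_nhds_unique (f := fun _ : ℕ => A t v) (l := atTop) tendsto_const_nhds ?_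
  rw [zero_apply, ← h2]
  exact h1.congr hinv

/-- Two `T`-periodic solutions of the non-homogeneous variational tensor equation along a
hyperbolic periodic orbit differ by `μ · Q⁽¹⁾ ⊗ ⋯ ⊗ Q⁽¹⁾`, where
`μ = Tᵏ·[A'₀(F_x,…,F_x) − A₀(F_x,…,F_x)]`. -/
theorem stmt_9 {n : ℕ}
    (F : EuclideanSpace ℝ (Fin n) → EuclideanSpace ℝ (Fin n)) (hF : ContDiff ℝ (⊤ : ℕ∞) F)
    (φ : ℝ → EuclideanSpace ℝ (Fin n) → EuclideanSpace ℝ (Fin n))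
    (hφ0 : ∀ y, φ 0 y = y)
    (hφsmooth : ContDiff ℝ (⊤ : ℕ∞) fun p : ℝ × EuclideanSpace ℝ (Fin n) => φ p.1 p.2)
    (hφflow : ∀ t y, HasDerivAt (fun s => φ s y) (F (φ t y)) t)
    (hφbij : ∀ t, Function.Bijective (φ t))
    (x : EuclideanSpace ℝ (Fin n)) (T : ℝ) (hT : 0 < T)
    (hper : φ T x = x) (hFx : F x ≠ 0)
    (W : ℝ → Submodule ℝ (EuclideanSpace ℝ (Fin n)))
    (hWcompl : ∀ t, IsCompl (Submodule.span ℝ {F (φ t x)}) (W t))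
    (hWinv : ∀ s t, Submodule.map (fderiv ℝ (φ s) (φ t x) : _ →ₗ[ℝ] _) (W t) = W (t + s))
    (hWper : ∀ t, W (t + T) = W t)
    (C lam : ℝ) (hC : 0 < C) (hlam0 : 0 < lam) (hlam1 : lam < 1)
    (hcontr : ∀ t : ℝ, ∀ s : ℝ, 0 ≤ s → ∀ v ∈ W t,
      ‖fderiv ℝ (φ s) (φ t x) v‖ ≤ C * lam ^ s * ‖v‖)
    (Q1 : ℝ → (EuclideanSpace ℝ (Fin n) →L[ℝ] ℝ))
    (hQ1per : ∀ t, Q1 (t + T) = Q1 t)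
    (hQ1ode : ∀ (t : ℝ) (v : EuclideanSpace ℝ (Fin n)),
      HasDerivAt (fun s => Q1 s v) (-(Q1 t (fderiv ℝ F (φ t x) v))) t)
    (hQ1norm : ∀ t, Q1 t (F (φ t x)) = 1 / T)
    (k : ℕ) (hk : 1 ≤ k)
    (B : ℝ → ContinuousMultilinearMap ℝ (fun _ : Fin k => EuclideanSpace ℝ (Fin n)) ℝ)
    (hBcont : Continuous B) (hBper : ∀ t, B (t + T) = B t)
    (A A' : ℝ → ContinuousMultilinearMap ℝ (fun _ : Fin k => EuclideanSpace ℝ (Fin n)) ℝ)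
    (hAper : ∀ t, A (t + T) = A t) (hA'per : ∀ t, A' (t + T) = A' t)
    (hAode : ∀ (t : ℝ) (v : Fin k → EuclideanSpace ℝ (Fin n)),
      HasDerivAt (fun s => A s v)
        (B t v - ∑ j : Fin k, A t (Function.update v j (fderiv ℝ F (φ t x) (v j)))) t)
    (hA'ode : ∀ (t : ℝ) (v : Fin k → EuclideanSpace ℝ (Fin n)),
      HasDerivAt (fun s => A' s v)
        (B t v - ∑ j : Fin k, A' t (Function.update v j (fderiv ℝ F (φ t x) (v j)))) t) :
    ∀ t, A' t = A t +
      (T ^ k * (A' 0 (fun _ => F x) - A 0 (fun _ => F x))) • tensorPow k (Q1 t) := by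
  intro t
  set μ : ℝ := T ^ k * (A' 0 (fun _ => F x) - A 0 (fun _ => F x)) with hμ
  have h : A' t - A t - μ • tensorPow k (Q1 t) = 0 := by
    refine eq_zero_of_periodic_of_variational (hF.of_le (by exact_mod_cast le_top)) hφ0
      (hφsmooth.of_le (WithTop.coe_le_coe.2 le_top)) hφflow hT hper hWcompl hlam0 hlam1 hcontr
      (A := fun t => A' t - A t - μ • tensorPow k (Q1 t)) (fun t => ?_) (fun t v => ?_) ?_ t
    · simp only [hAper, hA'per, hQ1per]
    · convert! ((hA'ode t v).sub (hAode t v)).sub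
        ((hasDerivAt_tensorPow (hQ1ode t) v).const_mul μ) using 1
      simp only [sub_apply, smul_apply,
        Finset.sum_sub_distrib, smul_eq_mul, Finset.mul_sum, mul_neg]
      ring
    · have hQ : Q1 0 (F x) = 1 / T := by simpa only [hφ0] using hQ1norm 0
      have hR : tensorPow k (Q1 0) (fun _ => F x) = (1 / T) ^ k := by
        simp [tensorPow, hQ]
      simp only [sub_apply, smul_apply, hR,
        smul_eq_mul, hμ]
      rw [mul_right_comm, ← mul_pow, mul_one_div_cancel hT.ne', one_pow, one_mul, sub_self]
  rw [sub_sub, sub_eq_zero] at h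
  exact h
end
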